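/- Fix 0 < q < 1 and let g : [0,∞) → ℝ be defined by g(x) = e^{−(1+c_q)x} ∑_{j=0}^{⌊x/log(1/q)⌋} q^{−j(1+c_q)} ∑_{k=0}^{j} ((x − j·log(1/q))^k / k!) · w_k(j), where c_q = ∑_{k=1}^∞ q^k/(1-q^k) and w_k(j) = ∑_{p_1+...+p_k=j, p_i≥1} ∏_{i=1}^k q^{2p_i}/(1-q^{p_i}) (with w_0(0)=1, w_0(j)=0 for j≥1). Then g is continuous on [0,∞) and g(x) → 0 as x → ∞. -/

import Mathlib

open MeasureTheory

/-- The Bernstein transform of the Jackson measure `d_q t`. -/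
noncomputable def fq (q : ℝ) (z : ℂ) : ℂ :=
  (1 - q) * (z + ∑' k : ℕ,
    (q : ℂ) ^ (k + 1) * (1 - (q : ℂ) ^ (((k : ℂ) + 1) * z)) / (1 - (q : ℂ) ^ (k + 1)))

/-- `c_q = ∑_{k=1}^∞ q^k/(1-q^k)`. -/
noncomputable def cq (q : ℝ) : ℝ := ∑' k : ℕ, q ^ (k + 1) / (1 - q ^ (k + 1))

/-- `w q k j = ∑_{p_1+⋯+p_k=j, p_i ≥ 1} ∏_i q^{2 p_i}/(1-q^{p_i})`, the mass at
`j log(1/q)` of the `k`-th convolution power of `∑_{p≥1} (q^{2p}/(1-q^p)) δ_{p log(1/q)}`. -/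
noncomputable def w (q : ℝ) (k j : ℕ) : ℝ :=
  ∑ p ∈ (Finset.Nat.antidiagonalTuple k j).filter (fun p => ∀ i, 1 ≤ p i),
    ∏ i, q ^ (2 * p i) / (1 - q ^ (p i))

/-- `(1-q)` times the density of the measure `τ_q`. -/
noncomputable def g (q : ℝ) (x : ℝ) : ℝ :=
  Real.exp (-(1 + cq q) * x) *
    ∑ j ∈ Finset.range (⌊x / Real.log (1 / q)⌋₊ + 1),
      q ^ (-(j : ℝ) * (1 + cq q)) *
        ∑ k ∈ Finset.range (j + 1),
          (x - j * Real.log (1 / q)) ^ k / (Nat.factorial k) * w q k j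

lemma summable_cq {q : ℝ} (hq0 : 0 < q) (hq1 : q < 1) :
    Summable fun k : ℕ => q ^ (k + 1) / (1 - q ^ (k + 1)) := by
  have hs : Summable fun k : ℕ => q ^ k * (q / (1 - q)) :=
    (summable_geometric_of_lt_one hq0.le hq1).mul_right _
  refine Summable.of_nonneg_of_le (fun k => ?_) (fun k => ?_) hs
  · have := pow_le_one₀ (n := k + 1) hq0.le hq1.le
    exact div_nonneg (by positivity) (by linarith)
  · have h1 : q ^ (k + 1) ≤ q := pow_le_of_le_one hq0.le hq1.le (by omega)
    rw [← mul_div_assoc, ← pow_succ]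
    exact div_le_div_of_nonneg_left (by positivity) (by linarith) (by linarith)

lemma one_sub_pow_pos {q : ℝ} (hq0 : 0 < q) (hq1 : q < 1) {p : ℕ} (hp : 1 ≤ p) :
    0 < 1 - q ^ p := by
  have := pow_lt_one₀ hq0.le hq1 (by omega : p ≠ 0)
  linarith

lemma cq_nonneg {q : ℝ} (hq0 : 0 < q) (hq1 : q < 1) : 0 ≤ cq q :=
  tsum_nonneg fun k => div_nonneg (by positivity)
    (one_sub_pow_pos hq0 hq1 (Nat.succ_le_succ k.zero_le)).le

lemma w_nonneg {q : ℝ} (hq0 : 0 < q) (hq1 : q < 1) (k j : ℕ) : 0 ≤ w q k j := by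
  refine Finset.sum_nonneg fun p hp => Finset.prod_nonneg fun i _ => ?_
  have := one_sub_pow_pos hq0 hq1 ((Finset.mem_filter.1 hp).2 i)
  positivity

/-- Tilting by `q ^ j` turns the base measure into one of total mass `cq q`. -/
lemma w_le {q : ℝ} (hq0 : 0 < q) (hq1 : q < 1) (k j : ℕ) : w q k j ≤ q ^ j * cq q ^ k := by
  have hsum : ∑ p ∈ Finset.Icc 1 j, q ^ p / (1 - q ^ p) ≤ cq q := by
    have h : ∑ p ∈ Finset.Icc 1 j, q ^ p / (1 - q ^ p)
        = ∑ i ∈ Finset.range j, q ^ (i + 1) / (1 - q ^ (i + 1)) := by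
      rw [Finset.range_eq_Ico, Finset.sum_Ico_add' (fun p => q ^ p / (1 - q ^ p)) 0 j 1]
      rfl
    rw [h]
    exact (summable_cq hq0 hq1).sum_le_tsum _ fun i _ => div_nonneg (by positivity)
      (one_sub_pow_pos hq0 hq1 (Nat.succ_le_succ i.zero_le)).le
  have hnn : ∀ p ∈ Finset.Icc 1 j, 0 ≤ q ^ p / (1 - q ^ p) := fun p hp => by
    have := one_sub_pow_pos hq0 hq1 (Finset.mem_Icc.1 hp).1
    positivity
  have hpow : ∑ p ∈ Fintype.piFinset fun _ : Fin k => Finset.Icc 1 j,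
      ∏ i, q ^ p i / (1 - q ^ p i) ≤ cq q ^ k := by
    rw [← Finset.prod_univ_sum (fun _ : Fin k => Finset.Icc 1 j)
      (fun _ p => q ^ p / (1 - q ^ p))]
    simpa using pow_le_pow_left₀ (Finset.sum_nonneg hnn) hsum k
  refine le_trans ?_ (mul_le_mul_of_nonneg_left hpow (by positivity))
  rw [Finset.mul_sum]
  have hterm : w q k j = ∑ p ∈ (Finset.Nat.antidiagonalTuple k j).filter (fun p => ∀ i, 1 ≤ p i),
      q ^ j * ∏ i, q ^ p i / (1 - q ^ p i) := by
    refine Finset.sum_congr rfl fun p hp => ?_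
    rw [← Finset.Nat.mem_antidiagonalTuple.1 (Finset.mem_filter.1 hp).1,
      ← Finset.prod_pow_eq_pow_sum, ← Finset.prod_mul_distrib]
    refine Finset.prod_congr rfl fun i _ => ?_
    ring
  rw [hterm]
  refine Finset.sum_le_sum_of_subset_of_nonneg (fun p hp => ?_) fun p hp _ => ?_
  · obtain ⟨hp, hp1⟩ := Finset.mem_filter.1 hp
    rw [Fintype.mem_piFinset]
    refine fun i => Finset.mem_Icc.2 ⟨hp1 i, ?_⟩
    rw [← Finset.Nat.mem_antidiagonalTuple.1 hp]
    exact Finset.single_le_sum (fun _ _ => Nat.zero_le _) (Finset.mem_univ i)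
  · exact mul_nonneg (by positivity)
      (Finset.prod_nonneg fun i _ => hnn _ (Fintype.mem_piFinset.1 hp i))

lemma w_zero_left {q : ℝ} {j : ℕ} (hj : j ≠ 0) : w q 0 j = 0 := by
  obtain ⟨n, rfl⟩ := Nat.exists_eq_succ_of_ne_zero hj
  simp [w]

lemma log_one_div_pos {q : ℝ} (hq0 : 0 < q) (hq1 : q < 1) : 0 < Real.log (1 / q) :=
  Real.log_pos (one_lt_one_div hq0 hq1)

lemma natCast_mul_le_of_lt_floor {L x : ℝ} (hL : 0 < L) (hx : 0 ≤ x) {j : ℕ}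
    (hj : j < ⌊x / L⌋₊ + 1) : (j : ℝ) * L ≤ x := by
  rw [← le_div_iff₀ hL]
  exact (Nat.le_floor_iff (by positivity)).1 (by omega)

lemma g_nonneg {q : ℝ} (hq0 : 0 < q) (hq1 : q < 1) {x : ℝ} (hx : 0 ≤ x) : 0 ≤ g q x := by
  refine mul_nonneg (Real.exp_pos _).le (Finset.sum_nonneg fun j hj => ?_)
  have h := natCast_mul_le_of_lt_floor (log_one_div_pos hq0 hq1) hx (Finset.mem_range.1 hj)
  refine mul_nonneg (by positivity) (Finset.sum_nonneg fun k _ => ?_)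
  have := w_nonneg hq0 hq1 k j
  have : 0 ≤ x - j * Real.log (1 / q) := by linarith
  positivity

lemma g_le {q : ℝ} (hq0 : 0 < q) (hq1 : q < 1) {x : ℝ} (hx : 0 ≤ x) :
    g q x ≤ (x / Real.log (1 / q) + 1) * Real.exp (-x) := by
  have hL := log_one_div_pos hq0 hq1
  have hc := cq_nonneg hq0 hq1
  have key : ∀ j ∈ Finset.range (⌊x / Real.log (1 / q)⌋₊ + 1),
      Real.exp (-(1 + cq q) * x) * (q ^ (-(j : ℝ) * (1 + cq q)) *
        ∑ k ∈ Finset.range (j + 1),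
          (x - j * Real.log (1 / q)) ^ k / (Nat.factorial k) * w q k j) ≤ Real.exp (-x) := by
    intro j hj
    have ht : 0 ≤ x - j * Real.log (1 / q) := by
      linarith [natCast_mul_le_of_lt_floor hL hx (Finset.mem_range.1 hj)]
    have hin : ∑ k ∈ Finset.range (j + 1),
          (x - j * Real.log (1 / q)) ^ k / (Nat.factorial k) * w q k j
        ≤ q ^ j * Real.exp (cq q * (x - j * Real.log (1 / q))) := by
      refine le_trans (Finset.sum_le_sum fun k _ =>
        mul_le_mul_of_nonneg_left (w_le hq0 hq1 k j) (by positivity)) ?_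
      refine le_trans (le_of_eq ?_) (mul_le_mul_of_nonneg_left
        (Real.sum_le_exp_of_nonneg (mul_nonneg hc ht) (j + 1)) (by positivity))
      rw [Finset.mul_sum]
      refine Finset.sum_congr rfl fun k _ => ?_
      rw [mul_pow]
      ring
    calc _ ≤ Real.exp (-(1 + cq q) * x) * (q ^ (-(j : ℝ) * (1 + cq q)) *
          (q ^ j * Real.exp (cq q * (x - j * Real.log (1 / q))))) := by gcongr
      _ = Real.exp (-x) := by
        rw [← Real.rpow_natCast q j, Real.rpow_def_of_pos hq0, Real.rpow_def_of_pos hq0,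
          ← Real.exp_add, ← Real.exp_add, ← Real.exp_add, one_div, Real.log_inv]
        congr 1
        ring
  rw [g, Finset.mul_sum]
  refine (Finset.sum_le_card_nsmul _ _ _ key).trans ?_
  rw [Finset.card_range, nsmul_eq_mul]
  push_cast
  gcongr
  exact Nat.floor_le (by positivity)

/-- Below `N log(1/q)` the floor-dependent sum is a fixed finite sum of continuous terms. -/
lemma g_eq_of_lt {q : ℝ} (hq0 : 0 < q) (hq1 : q < 1) {x : ℝ} (hx : 0 ≤ x) {N : ℕ}
    (hN : x < N * Real.log (1 / q)) :
    g q x = Real.exp (-(1 + cq q) * x) *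
      ∑ j ∈ Finset.range N, q ^ (-(j : ℝ) * (1 + cq q)) *
        ∑ k ∈ Finset.range (j + 1),
          (max (x - j * Real.log (1 / q)) 0) ^ k / (Nat.factorial k) * w q k j := by
  have hL := log_one_div_pos hq0 hq1
  have hfl : ⌊x / Real.log (1 / q)⌋₊ + 1 ≤ N :=
    (Nat.floor_lt (by positivity)).2 ((div_lt_iff₀ hL).2 hN)
  rw [g]
  congr 1
  rw [← Finset.sum_subset (Finset.range_mono hfl)]
  · refine Finset.sum_congr rfl fun j hj => ?_
    have := natCast_mul_le_of_lt_floor hL hx (Finset.mem_range.1 hj)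
    rw [max_eq_left (by linarith)]
  · intro j _ hj
    have hj : ⌊x / Real.log (1 / q)⌋₊ < j := by simpa using hj
    have hxj := (div_lt_iff₀ hL).1 ((Nat.floor_lt (by positivity)).1 hj)
    rw [max_eq_right (by linarith)]
    refine mul_eq_zero_of_right _ (Finset.sum_eq_zero fun k _ => ?_)
    rcases k with _ | k
    · rw [w_zero_left (by omega), mul_zero]
    · simp

lemma continuousOn_g {q : ℝ} (hq0 : 0 < q) (hq1 : q < 1) :
    ContinuousOn (g q) (Set.Ici (0 : ℝ)) := by
  have hL := log_one_div_pos hq0 hq1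
  refine continuousOn_of_locally_continuousOn fun x _ => ?_
  obtain ⟨N, hN⟩ := exists_nat_gt (x / Real.log (1 / q))
  refine ⟨Set.Iio (N * Real.log (1 / q)), isOpen_Iio, (div_lt_iff₀ hL).1 hN, ?_⟩
  refine ContinuousOn.congr (Continuous.continuousOn ?_)
    fun y hy => g_eq_of_lt hq0 hq1 hy.1 hy.2
  fun_prop

lemma tendsto_g_atTop {q : ℝ} (hq0 : 0 < q) (hq1 : q < 1) :
    Filter.Tendsto (g q) Filter.atTop (nhds 0) := by
  have h1 : Filter.Tendsto (fun x : ℝ => (x / Real.log (1 / q) + 1) * Real.exp (-x))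
      Filter.atTop (nhds 0) := by
    have h := ((Real.tendsto_pow_mul_exp_neg_atTop_nhds_zero 1).div_const
      (Real.log (1 / q))).add (Real.tendsto_pow_mul_exp_neg_atTop_nhds_zero 0)
    rw [zero_div, add_zero] at h
    refine h.congr fun x => ?_
    ring
  refine squeeze_zero' ?_ ?_ h1
  · filter_upwards [Filter.eventually_ge_atTop 0] with x hx using g_nonneg hq0 hq1 hx
  · filter_upwards [Filter.eventually_ge_atTop 0] with x hx using g_le hq0 hq1 hx

theorem stmt14 (q : ℝ) (hq0 : 0 < q) (hq1 : q < 1) :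
    ContinuousOn (g q) (Set.Ici (0:ℝ)) ∧
      Filter.Tendsto (g q) Filter.atTop (nhds 0) := by
  exact ⟨continuousOn_g hq0 hq1, tendsto_g_atTop hq0 hq1⟩
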